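/- Let m ≥ 1 be fixed and let S = n√(2/π). There exist constants c₄ > 0, β > 0, and δ' > 0 such that, for all n ≥ m sufficiently large, with probability at least 1 − e^{−c₄ n} the random n×m Toeplitz matrix H built from i.i.d. standard Gaussian N(0,1) inputs has the property: for every z ∈ ℝ^m with ‖z‖₂ = 1 and every subset K ⊆ {1,…,n} with |K| ≤ β n, Σ_{i∈K̄} |(Hz)_i| − Σ_{i∈K} |(Hz)_i| ≥ δ' S, where K̄ = {1,…,n} \ K. -/

import Mathlib

open MeasureTheory ProbabilityTheory Finset Filter

noncomputable section

/-- The `n × m` Toeplitz matrix built from the input sequence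
`h = (h_{-m+2}, …, h_n)`, reindexed as `h : Fin (n+m-1) → ℝ`;
the `(i,j)` entry (0-based) is the input with index `i + j`, which corresponds to
`H_{i,j} = h_{i-m+j}` in 1-based indexing. -/
def toeplitz (n m : ℕ) (h : Fin (n + m - 1) → ℝ) : Matrix (Fin n) (Fin m) ℝ :=
  fun i j => h ⟨i.1 + j.1, by have := i.2; have := j.2; omega⟩

/-- The ℓ¹ norm of a vector in `ℝ^k`. -/
def l1 {k : ℕ} (v : Fin k → ℝ) : ℝ := ∑ i, |v i|

/-- The Euclidean (ℓ²) norm of a vector in `ℝ^k`. -/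
def l2 {k : ℕ} (v : Fin k → ℝ) : ℝ := Real.sqrt (∑ i, (v i) ^ 2)

/-- Product of `d` i.i.d. standard Gaussian `N(0,1)` measures on `ℝ^d`. -/
def gaussPi (d : ℕ) : Measure (Fin d → ℝ) := Measure.pi fun _ => gaussianReal 0 1

/-- The standard Gaussian cumulative distribution function `Φ`. -/
def stdGaussianCDF (t : ℝ) : ℝ :=
  (Real.sqrt (2 * Real.pi))⁻¹ * ∫ x in Set.Iic t, Real.exp (-x ^ 2 / 2)

open Classical in
/-- Number of nonzero entries of a vector. -/
def sparsity {k : ℕ} (v : Fin k → ℝ) : ℕ := (Finset.univ.filter fun i => v i ≠ 0).card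

instance gaussPi_prob (d : ℕ) : IsProbabilityMeasure (gaussPi d) := by
  unfold gaussPi; infer_instance

lemma gaussPi_indep (d : ℕ) : iIndepFun (fun (i : Fin d) (h : Fin d → ℝ) => h i) (gaussPi d) :=
  iIndepFun_pi (X := fun _ => id) (fun _ => aemeasurable_id)

lemma gaussPi_eval (d : ℕ) (i : Fin d) :
    MeasurePreserving (fun h : Fin d → ℝ => h i) (gaussPi d) (gaussianReal 0 1) :=
  measurePreserving_eval (fun _ : Fin d => gaussianReal 0 1) i

lemma blocks_meas (d M L : ℕ) (g : Fin M × Fin L → Fin d) (hg : Function.Injective g)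
    (S : Fin L → Set ℝ) (hS : ∀ i, MeasurableSet (S i)) (s : Finset (Fin M)) :
    gaussPi d (⋂ b ∈ s, {h | ∀ i, h (g (b, i)) ∈ S i}) =
      ∏ _b ∈ s, ∏ i, gaussianReal 0 1 (S i) := by
  have h1 := ((gaussPi_indep d).precomp hg).measure_inter_preimage_eq_mul
    (S := s ×ˢ Finset.univ) (sets := fun q => S q.2) (fun q _ => hS q.2)
  have h2 : (⋂ b ∈ s, {h : Fin d → ℝ | ∀ i, h (g (b, i)) ∈ S i}) =
      ⋂ q ∈ s ×ˢ Finset.univ, (fun h : Fin d → ℝ => h (g q)) ⁻¹' S q.2 := by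
    ext h
    simp only [Set.mem_iInter, Set.mem_ofPred_eq, Finset.mem_product, Finset.mem_univ, and_true,
      Set.mem_preimage, Prod.forall]
    exact ⟨fun H a b ha => H a ha b, fun H a ha b => H a b ha⟩
  rw [h2]
  refine h1.trans ?_
  rw [Finset.prod_product]
  refine Finset.prod_congr rfl fun b _ => Finset.prod_congr rfl fun i _ => ?_
  exact (gaussPi_eval d (g (b, i))).measure_preimage (hS i).nullMeasurableSet

open Classical in
lemma blocks_prob (d M L : ℕ) (g : Fin M × Fin L → Fin d) (hg : Function.Injective g)
    (S : Fin L → Set ℝ) (hS : ∀ i, MeasurableSet (S i)) (p : ℝ)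
    (hp : p = (∏ i, gaussianReal 0 1 (S i)).toReal) :
    (gaussPi d).real {h | ((Finset.univ.filter fun b => ∀ i, h (g (b, i)) ∈ S i).card : ℝ)
      ≤ p * M / 2} ≤ Real.exp (-(p ^ 2 * M / 2)) := by
  set A : Fin M → Set (Fin d → ℝ) := fun b => {h | ∀ i, h (g (b, i)) ∈ S i} with hA
  have hAm : ∀ b, MeasurableSet (A b) := by
    intro b
    have : A b = ⋂ i, (fun h : Fin d → ℝ => h (g (b, i))) ⁻¹' S i := by ext; simp [hA]
    rw [this]
    exact MeasurableSet.iInter fun i => (measurable_pi_apply _) (hS i)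
  have hAp : ∀ b, gaussPi d (A b) = ∏ i, gaussianReal 0 1 (S i) := by
    intro b
    have := blocks_meas d M L g hg S hS {b}
    simpa using this
  have hind : iIndepSet A (gaussPi d) := by
    rw [iIndepSet_iff_meas_biInter hAm]
    intro s
    rw [blocks_meas d M L g hg S hS s]
    exact Finset.prod_congr rfl fun b _ => (hAp b).symm
  have hf := hind.iIndepFun_indicator (β := ℝ) (m := inferInstance)
  have hX := hf.comp (fun _ x => -x - -p) (fun _ => by fun_prop)
  have hsub : ∀ b ∈ (Finset.univ : Finset (Fin M)),
      HasSubgaussianMGF ((fun x : ℝ => -x - -p) ∘ ((A b).indicator fun _ => (1:ℝ)))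
        ((‖(0:ℝ) - (-1)‖₊ / 2) ^ 2) (gaussPi d) := by
    intro b _
    have h1 := hasSubgaussianMGF_of_mem_Icc (μ := gaussPi d) (a := -1) (b := 0)
      (X := fun h => -((A b).indicator (fun _ => (1:ℝ)) h))
      ((measurable_const.indicator (hAm b)).neg.aemeasurable) (by
        refine Filter.Eventually.of_forall fun h => ?_
        by_cases hh : h ∈ A b <;> simp [hh])
    have h2 : (∫ h, -((A b).indicator (fun _ => (1:ℝ)) h) ∂(gaussPi d)) = -p := by
      rw [integral_neg, integral_indicator_const _ (hAm b)]
      simp [Measure.real, hAp, hp]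
    rw [h2] at h1
    exact h1
  have hp0 : 0 ≤ p := hp ▸ ENNReal.toReal_nonneg
  have key := HasSubgaussianMGF.measure_sum_ge_le_of_iIndepFun hX hsub (ε := p * M / 2)
    (by positivity)
  refine (measureReal_mono ?_).trans (key.trans ?_)
  · intro h hh
    simp only [Set.mem_ofPred_eq] at hh ⊢
    have : ∑ b : Fin M, ((fun x : ℝ => -x - -p) ∘ ((A b).indicator fun _ => (1:ℝ))) h =
        p * M - ((Finset.univ.filter fun b => ∀ i, h (g (b, i)) ∈ S i).card : ℝ) := by
      simp [Finset.sum_add_distrib, Set.indicator_apply, hA]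
      ring
    rw [this]; linarith
  · apply Real.exp_le_exp.2
    rcases Nat.eq_zero_or_pos M with h0 | h0
    · subst h0; simp
    · have : (0:ℝ) < M := by exact_mod_cast h0
      simp
      apply le_of_eq
      field_simp
      try norm_num

lemma exists_T (q : ℝ) (hq : 1 < q) : ∃ T : ℝ, 1 ≤ T ∧
    ∫ x, Real.exp (max (|x| - T) 0) ∂(gaussianReal 0 1) ≤ q := by
  have hint : Integrable (fun x : ℝ => Real.exp (1 * x) + Real.exp ((-1) * x)) (gaussianReal 0 1) :=
    (integrable_exp_mul_gaussianReal 1).add (integrable_exp_mul_gaussianReal (-1))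
  have hb : ∀ T : ℝ, 0 ≤ T → ∀ x : ℝ, Real.exp (max (|x| - T) 0) ≤
      Real.exp (1 * x) + Real.exp ((-1) * x) := by
    intro T hT x
    have h1 : max (|x| - T) 0 ≤ |x| := max_le (by linarith) (abs_nonneg x)
    refine (Real.exp_le_exp.2 h1).trans ?_
    have e1 := Real.exp_pos (1 * x)
    have e2 := Real.exp_pos ((-1) * x)
    rcases abs_cases x with ⟨h, _⟩ | ⟨h, _⟩ <;> rw [h]
    · rw [one_mul] at *; linarith
    · rw [neg_one_mul] at *; linarith
  have ht : Tendsto (fun T : ℝ => ∫ x, Real.exp (max (|x| - T) 0) ∂(gaussianReal 0 1)) atTop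
      (nhds (∫ _x, (1:ℝ) ∂(gaussianReal 0 1))) := by
    refine tendsto_integral_filter_of_dominated_convergence _ ?_ ?_ hint ?_
    · exact Filter.Eventually.of_forall fun T => by
        apply Measurable.aestronglyMeasurable; fun_prop
    · filter_upwards [eventually_ge_atTop 0] with T hT
      refine Filter.Eventually.of_forall fun x => ?_
      rw [Real.norm_of_nonneg (Real.exp_pos _).le]
      exact hb T hT x
    · refine Filter.Eventually.of_forall fun x => ?_
      apply tendsto_const_nhds.congr'
      filter_upwards [eventually_ge_atTop |x|] with T hT
      rw [max_eq_right (by linarith), Real.exp_zero]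
  simp only [integral_const, probReal_univ, smul_eq_mul, mul_one] at ht
  obtain ⟨T, h1, h2⟩ := ((ht.eventually (gt_mem_nhds hq)).and (eventually_ge_atTop 1)).exists
  exact ⟨T, h2, h1.le⟩

lemma excess_int (T : ℝ) (hT : 1 ≤ T) :
    Integrable (fun x : ℝ => Real.exp (max (|x| - T) 0)) (gaussianReal 0 1) := by
  have hint : Integrable (fun x : ℝ => Real.exp (1 * x) + Real.exp ((-1) * x)) (gaussianReal 0 1) :=
    (integrable_exp_mul_gaussianReal 1).add (integrable_exp_mul_gaussianReal (-1))
  refine hint.mono' (by apply Measurable.aestronglyMeasurable; fun_prop) ?_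
  refine Filter.Eventually.of_forall fun x => ?_
  rw [Real.norm_of_nonneg (Real.exp_pos _).le]
  have h1 : max (|x| - T) 0 ≤ |x| := max_le (by linarith) (abs_nonneg x)
  refine (Real.exp_le_exp.2 h1).trans ?_
  have e1 := Real.exp_pos (1 * x)
  have e2 := Real.exp_pos ((-1) * x)
  rcases abs_cases x with ⟨h, _⟩ | ⟨h, _⟩ <;> rw [h]
  · rw [one_mul] at *; linarith
  · rw [neg_one_mul] at *; linarith

lemma excess_prob (ε : ℝ) (hε : 0 < ε) : ∃ T : ℝ, 1 ≤ T ∧ ∀ d : ℕ,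
    (gaussPi d).real {h | ε * d ≤ ∑ k, max (|h k| - T) 0} ≤ Real.exp (-(ε / 2 * d)) := by
  obtain ⟨T, hT, hq⟩ := exists_T (Real.exp (ε / 2)) (Real.one_lt_exp_iff.2 (by positivity))
  refine ⟨T, hT, fun d => ?_⟩
  have hX := (gaussPi_indep d).comp (fun _ x => max (|x| - T) 0) (fun _ => by fun_prop)
  have hXm : ∀ k : Fin d, Measurable ((fun x : ℝ => max (|x| - T) 0) ∘
      (fun h : Fin d → ℝ => h k)) := fun k => by
    have h1 : Measurable (fun x : ℝ => max (|x| - T) 0) := by fun_prop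
    exact h1.comp (measurable_pi_apply k)
  have hi : ∀ k : Fin d, Integrable (fun h : Fin d → ℝ => Real.exp (1 * ((fun x : ℝ =>
      max (|x| - T) 0) ∘ (fun h : Fin d → ℝ => h k)) h)) (gaussPi d) := fun k => by
    simpa [Function.comp_def] using (gaussPi_eval d k).integrable_comp_of_integrable
      (excess_int T hT)
  have hm := hX.mgf_sum hXm (t := 1) Finset.univ
  have hsi := hX.integrable_exp_mul_sum (t := 1) hXm (s := Finset.univ) (fun k _ => hi k)
  have key := measure_ge_le_exp_mul_mgf (ε * d) zero_le_one hsi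
  rw [hm] at key
  have hk : ∀ k : Fin d, mgf ((fun x : ℝ => max (|x| - T) 0) ∘ (fun h : Fin d → ℝ => h k))
      (gaussPi d) 1 ≤ Real.exp (ε / 2) := by
    intro k
    refine le_trans (le_of_eq ?_) hq
    rw [mgf, ← (gaussPi_eval d k).map_eq, integral_map (measurable_pi_apply k).aemeasurable
      (by apply Measurable.aestronglyMeasurable; fun_prop)]
    simp
  have hprod : ∏ k : Fin d, mgf ((fun x : ℝ => max (|x| - T) 0) ∘ (fun h : Fin d → ℝ => h k))
      (gaussPi d) 1 ≤ Real.exp (ε / 2) ^ d := by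
    refine (Finset.prod_le_prod (fun k _ => mgf_nonneg) (fun k _ => hk k)).trans ?_
    simp
  have e : Real.exp (-1 * (ε * d)) * Real.exp (ε / 2) ^ d = Real.exp (-(ε / 2 * d)) := by
    rw [← Real.exp_nat_mul, ← Real.exp_add]; congr 1; ring
  rw [← e]
  refine le_trans ?_ (key.trans (mul_le_mul_of_nonneg_left hprod (Real.exp_pos _).le))
  refine measureReal_mono ?_
  intro h hh
  simpa using hh

def blockS (m : ℕ) (i : Fin (2 * m - 1)) : Set ℝ :=
  if i.1 = m - 1 then Set.Icc 1 2 else Set.Icc (-(1 / (2 * m))) (1 / (2 * m))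

lemma blockS_meas (m : ℕ) (i : Fin (2 * m - 1)) : MeasurableSet (blockS m i) := by
  unfold blockS; split_ifs <;> exact measurableSet_Icc

lemma gauss_Icc_ne (a b : ℝ) (hab : a < b) : gaussianReal 0 1 (Set.Icc a b) ≠ 0 := by
  intro h
  have := gaussianReal_absolutelyContinuous' 0 (v := 1) one_ne_zero h
  rw [Real.volume_Icc, ENNReal.ofReal_eq_zero] at this
  linarith

lemma blockS_pos (m : ℕ) (hm : 1 ≤ m) : 0 < (∏ i, gaussianReal 0 1 (blockS m i)).toReal := by
  have hm' : (0:ℝ) < m := by exact_mod_cast hm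
  apply ENNReal.toReal_pos
  · rw [Finset.prod_ne_zero_iff]
    intro i _
    unfold blockS
    split_ifs
    · exact gauss_Icc_ne _ _ (by norm_num)
    · apply gauss_Icc_ne
      have : 0 < 1 / (2 * (m:ℝ)) := by positivity
      linarith
  · exact (ENNReal.prod_lt_top fun i _ => measure_lt_top _ _).ne

lemma l2_facts {m : ℕ} (z : Fin m → ℝ) (hz : l2 z = 1) :
    (∀ j, |z j| ≤ 1) ∧ 1 ≤ ∑ j, |z j| := by
  have h1 : ∑ j, (z j) ^ 2 = 1 := by
    have := hz
    unfold l2 at this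
    rwa [Real.sqrt_eq_one] at this
  have h2 : ∀ j, |z j| ≤ 1 := by
    intro j
    rw [← sq_le_one_iff_abs_le_one, ← h1]
    exact Finset.single_le_sum (f := fun j => z j ^ 2) (fun i _ => sq_nonneg _) (Finset.mem_univ j)
  refine ⟨h2, ?_⟩
  rw [← h1]
  refine Finset.sum_le_sum fun j _ => ?_
  rw [← sq_abs]
  nlinarith [abs_nonneg (z j), h2 j]

lemma row_lower {m : ℕ} (hm : 1 ≤ m) (x : Fin (2 * m - 1) → ℝ) (hx : ∀ i, x i ∈ blockS m i)
    (z : Fin m → ℝ) (r : Fin m) :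
    |z r.rev| - 1 / (2 * m) * ∑ j, |z j| ≤
      |∑ j : Fin m, x ⟨r.1 + j.1, by have := r.2; have := j.2; omega⟩ * z j| := by
  have hm' : (0:ℝ) < m := by exact_mod_cast hm
  set y : Fin m → ℝ := fun j => x ⟨r.1 + j.1, by have := r.2; have := j.2; omega⟩ with hy
  have hc : 1 ≤ y r.rev := by
    have := hx ⟨r.1 + r.rev.1, by have := r.2; have := r.rev.2; omega⟩
    unfold blockS at this
    rw [if_pos (by simp only [Fin.val_rev]; have := r.2; omega)] at this
    exact this.1
  have ho : ∀ j, j ≠ r.rev → |y j| ≤ 1 / (2 * m) := by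
    intro j hj
    have := hx ⟨r.1 + j.1, by have := r.2; have := j.2; omega⟩
    unfold blockS at this
    rw [if_neg (by
      intro h; apply hj; ext; simp only [Fin.val_rev] at *; have := r.2; omega)] at this
    exact abs_le.2 this
  have h1 : |∑ j ∈ Finset.univ.erase r.rev, y j * z j| ≤ 1 / (2 * m) * ∑ j, |z j| := by
    refine (Finset.abs_sum_le_sum_abs _ _).trans ?_
    calc ∑ j ∈ Finset.univ.erase r.rev, |y j * z j|
        ≤ ∑ j ∈ Finset.univ.erase r.rev, 1 / (2 * m) * |z j| := by
          refine Finset.sum_le_sum fun j hj => ?_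
          rw [abs_mul]
          exact mul_le_mul_of_nonneg_right (ho j (Finset.ne_of_mem_erase hj)) (abs_nonneg _)
      _ ≤ ∑ j, 1 / (2 * m) * |z j| :=
          Finset.sum_le_sum_of_subset_of_nonneg (Finset.subset_univ _)
            (fun _ _ _ => by positivity)
      _ = _ := by rw [Finset.mul_sum]
  have h2 : |z r.rev| ≤ |y r.rev * z r.rev| := by
    rw [abs_mul]
    exact le_mul_of_one_le_left (abs_nonneg _) (hc.trans (le_abs_self _))
  have h3 := abs_sub_abs_le_abs_sub (y r.rev * z r.rev) (-∑ j ∈ Finset.univ.erase r.rev, y j * z j)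
  rw [abs_neg, sub_neg_eq_add] at h3
  have h4 := Finset.add_sum_erase Finset.univ (fun j => y j * z j) (Finset.mem_univ r.rev)
  rw [h4] at h3
  change _ ≤ |∑ j, y j * z j|
  linarith

lemma block_lower {m : ℕ} (hm : 1 ≤ m) (x : Fin (2 * m - 1) → ℝ) (hx : ∀ i, x i ∈ blockS m i)
    (z : Fin m → ℝ) (hz : l2 z = 1) :
    1 / 2 ≤ ∑ r : Fin m,
      |∑ j : Fin m, x ⟨r.1 + j.1, by have := r.2; have := j.2; omega⟩ * z j| := by
  have hm' : (0:ℝ) < m := by exact_mod_cast hm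
  refine le_trans ?_ (Finset.sum_le_sum fun r _ => row_lower hm x hx z r)
  have hrev : ∑ r : Fin m, |z r.rev| = ∑ j, |z j| :=
    Equiv.sum_comp Fin.revPerm (fun j => |z j|)
  rw [Finset.sum_sub_distrib, hrev]
  have := (l2_facts z hz).2
  simp only [Finset.sum_const, Finset.card_univ, Fintype.card_fin, nsmul_eq_mul]
  have e : (m:ℝ) * (1 / (2 * m) * ∑ j, |z j|) = (∑ j, |z j|) / 2 := by field_simp
  rw [e]; linarith

lemma blk_lt {n L : ℕ} (b : Fin (n / L)) (i : ℕ) (hi : i < L) : b.1 * L + i < n := by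
  have h1 : (b.1 + 1) * L ≤ n / L * L := Nat.mul_le_mul_right _ b.2
  have h2 := Nat.div_mul_le_self n L
  have h3 : (b.1 + 1) * L = b.1 * L + L := by ring
  omega

def blkG (n m : ℕ) (hm : 1 ≤ m) (q : Fin (n / (2 * m - 1)) × Fin (2 * m - 1)) :
    Fin (n + m - 1) :=
  ⟨q.1.1 * (2 * m - 1) + q.2.1, by have := blk_lt q.1 q.2.1 q.2.2; omega⟩

lemma blk_inj {L b c i j : ℕ} (hi : i < L) (hj : j < L) (h : b * L + i = c * L + j) :
    b = c ∧ i = j := by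
  have hL : 0 < L := by omega
  have h1 : (b * L + i) / L = b := by
    rw [mul_comm, Nat.mul_add_div hL, Nat.div_eq_of_lt hi, add_zero]
  have h2 : (c * L + j) / L = c := by
    rw [mul_comm, Nat.mul_add_div hL, Nat.div_eq_of_lt hj, add_zero]
  have : b = c := by rw [← h1, h, h2]
  subst this
  exact ⟨rfl, by omega⟩

lemma blkG_inj (n m : ℕ) (hm : 1 ≤ m) : Function.Injective (blkG n m hm) := by
  rintro ⟨b, i⟩ ⟨c, j⟩ h
  have h' := congrArg Fin.val h
  simp only [blkG] at h'
  obtain ⟨h1, h2⟩ := blk_inj i.2 j.2 h'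
  ext <;> assumption

open Classical in
lemma total_lower (n m : ℕ) (hm : 1 ≤ m) (h : Fin (n + m - 1) → ℝ) (z : Fin m → ℝ)
    (hz : l2 z = 1) :
    ((Finset.univ.filter fun b => ∀ i, h (blkG n m hm (b, i)) ∈ blockS m i).card : ℝ) / 2 ≤
      ∑ i, |(toeplitz n m h).mulVec z i| := by
  set G := Finset.univ.filter fun b => ∀ i, h (blkG n m hm (b, i)) ∈ blockS m i with hG
  let f : Fin (n / (2 * m - 1)) × Fin m → Fin n := fun q =>
    ⟨q.1.1 * (2 * m - 1) + q.2.1, blk_lt q.1 q.2.1 (by have := q.2.2; omega)⟩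
  have hf : Function.Injective f := by
    rintro ⟨b, i⟩ ⟨c, j⟩ h
    have h' := congrArg Fin.val h
    simp only [f] at h'
    obtain ⟨h1, h2⟩ := blk_inj (by have := i.2; omega) (by have := j.2; omega) h'
    ext <;> assumption
  calc (G.card : ℝ) / 2 = ∑ _b ∈ G, (1:ℝ) / 2 := by simp; ring
    _ ≤ ∑ b ∈ G, ∑ r : Fin m, |(toeplitz n m h).mulVec z (f (b, r))| := by
        refine Finset.sum_le_sum fun b hb => ?_
        have hb' := (Finset.mem_filter.1 hb).2
        refine (block_lower hm (fun i => h (blkG n m hm (b, i))) hb' z hz).trans (le_of_eq ?_)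
        refine Finset.sum_congr rfl fun r _ => ?_
        congr 1
        simp only [Matrix.mulVec, dotProduct]
        refine Finset.sum_congr rfl fun j _ => ?_
        congr 1
        simp only [toeplitz, blkG, f, add_assoc]
    _ = ∑ q ∈ G ×ˢ Finset.univ, |(toeplitz n m h).mulVec z (f q)| := by
        rw [Finset.sum_product]
    _ = ∑ i ∈ (G ×ˢ Finset.univ).map ⟨f, hf⟩, |(toeplitz n m h).mulVec z i| := by
        rw [Finset.sum_map]; rfl
    _ ≤ _ := Finset.sum_le_sum_of_subset_of_nonneg (Finset.subset_univ _)
            (fun _ _ _ => abs_nonneg _)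

lemma K_upper (n m : ℕ) (h : Fin (n + m - 1) → ℝ) (z : Fin m → ℝ)
    (hz : l2 z = 1) (T : ℝ) (K : Finset (Fin n)) :
    ∑ i ∈ K, |(toeplitz n m h).mulVec z i| ≤
      m * T * K.card + m * ∑ k, max (|h k| - T) 0 := by
  have hz1 := (l2_facts z hz).1
  have hi : ∀ i : Fin n, ∀ j : Fin m, i.1 + j.1 < n + m - 1 := fun i j => by
    have := i.2; have := j.2; omega
  have h1 : ∀ i, |(toeplitz n m h).mulVec z i| ≤
      ∑ j : Fin m, (T + max (|h ⟨i.1 + j.1, hi i j⟩| - T) 0) := by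
    intro i
    simp only [Matrix.mulVec, dotProduct, toeplitz]
    refine (Finset.abs_sum_le_sum_abs _ _).trans (Finset.sum_le_sum fun j _ => ?_)
    rw [abs_mul]
    have := mul_le_of_le_one_right (abs_nonneg (h ⟨i.1 + j.1, hi i j⟩)) (hz1 j)
    have := le_max_left (|h ⟨i.1 + j.1, hi i j⟩| - T) 0
    linarith
  have h2 : ∀ j : Fin m, ∑ i ∈ K, max (|h ⟨i.1 + j.1, hi i j⟩| - T) 0 ≤
      ∑ k, max (|h k| - T) 0 := by
    intro j
    let f : Fin n → Fin (n + m - 1) := fun i => ⟨i.1 + j.1, hi i j⟩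
    have hf : Function.Injective f := by
      intro a b hab
      have := congrArg Fin.val hab
      simp only [f] at this
      ext; omega
    calc ∑ i ∈ K, max (|h ⟨i.1 + j.1, hi i j⟩| - T) 0
        = ∑ k ∈ K.map ⟨f, hf⟩, max (|h k| - T) 0 := by rw [Finset.sum_map]; rfl
      _ ≤ _ := Finset.sum_le_sum_of_subset_of_nonneg (Finset.subset_univ _)
            (fun _ _ _ => le_max_right _ _)
  calc ∑ i ∈ K, |(toeplitz n m h).mulVec z i|
      ≤ ∑ i ∈ K, ∑ j : Fin m, (T + max (|h ⟨i.1 + j.1, hi i j⟩| - T) 0) :=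
        Finset.sum_le_sum fun i _ => h1 i
    _ = m * T * K.card + ∑ j : Fin m, ∑ i ∈ K, max (|h ⟨i.1 + j.1, hi i j⟩| - T) 0 := by
        rw [Finset.sum_comm]
        simp only [Finset.sum_add_distrib, Finset.sum_const, nsmul_eq_mul, Finset.card_univ,
          Fintype.card_fin]
        ring
    _ ≤ m * T * K.card + ∑ j : Fin m, ∑ k, max (|h k| - T) 0 := by
        gcongr with j; exact h2 j
    _ = _ := by simp

/-- For fixed `m ≥ 1` there exist constants `c₄, β, δ' > 0` such that,
with probability at least `1 - e^{-c₄ n}` for large `n ≥ m`, the Gaussian Toeplitz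
matrix satisfies: for every unit vector `z` and every `K` with `|K| ≤ β n`,
`∑_{i∈K̄}|(Hz)_i| - ∑_{i∈K}|(Hz)_i| ≥ δ'·S` with `S = n√(2/π)`. -/
theorem stmt4 (m : ℕ) (hm : 1 ≤ m) :
    ∃ c₄ : ℝ, 0 < c₄ ∧ ∃ β : ℝ, 0 < β ∧ ∃ δ' : ℝ, 0 < δ' ∧
      ∃ N : ℕ, ∀ n : ℕ, N ≤ n → m ≤ n →
        ENNReal.ofReal (1 - Real.exp (-c₄ * n)) ≤
          gaussPi (n + m - 1)
            {h | ∀ z : Fin m → ℝ, l2 z = 1 →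
              ∀ K : Finset (Fin n), (K.card : ℝ) ≤ β * n →
                δ' * ((n : ℝ) * Real.sqrt (2 / Real.pi)) ≤
                  ∑ i ∈ Kᶜ, |(toeplitz n m h).mulVec z i| -
                    ∑ i ∈ K, |(toeplitz n m h).mulVec z i|} := by
  classical
  have hm' : (1:ℝ) ≤ m := by exact_mod_cast hm
  set L : ℕ := 2 * m - 1 with hL
  have hL1 : 1 ≤ L := by omega
  have hL' : (1:ℝ) ≤ L := by exact_mod_cast hL1
  set p : ℝ := (∏ i, gaussianReal 0 1 (blockS m i)).toReal with hp
  have hp0 : 0 < p := blockS_pos m hm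
  set ε : ℝ := p / (128 * m * L) with hε
  have hε0 : 0 < ε := by positivity
  obtain ⟨T, hT, hexc⟩ := excess_prob ε hε0
  have hT0 : 0 < T := by linarith
  set c : ℝ := min (p ^ 2 / (4 * L)) (ε / 2) / 2 with hc
  have hc0 : 0 < c := by positivity
  have hc1 : 2 * c ≤ p ^ 2 / (4 * L) := by
    have := min_le_left (p ^ 2 / (4 * L)) (ε / 2); linarith
  have hc2 : 2 * c ≤ ε / 2 := by
    have := min_le_right (p ^ 2 / (4 * L)) (ε / 2); linarith
  refine ⟨c, hc0, p / (64 * L * m * T), by positivity, p / (16 * L), by positivity,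
    max L ⌈1 / c⌉₊, fun n hn hmn => ?_⟩
  have hnL : L ≤ n := (le_max_left _ _).trans hn
  have hnc : 1 / c ≤ n := (Nat.le_ceil _).trans (by exact_mod_cast (le_max_right _ _).trans hn)
  have hn0 : (0:ℝ) < n := by
    have : 0 < n := by omega
    exact_mod_cast this
  have hcn : 1 ≤ c * n := by rw [div_le_iff₀ hc0] at hnc; linarith
  have hM : (n:ℝ) / (2 * L) ≤ ((n / L : ℕ) : ℝ) := by
    rw [div_le_iff₀ (by positivity)]
    have h1 : n < (n / L + 1) * L := by
      have := Nat.lt_mul_div_succ n (show 0 < L by omega)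
      rwa [mul_comm]
    have h2 : 1 ≤ n / L := (Nat.one_le_div_iff (by omega)).2 hnL
    have h3 : n ≤ n / L * (2 * L) := by nlinarith
    exact_mod_cast h3
  set M : ℕ := n / L with hMdef
  set B1 : Set (Fin (n + m - 1) → ℝ) := {h | ((Finset.univ.filter fun b => ∀ i,
    h (blkG n m hm (b, i)) ∈ blockS m i).card : ℝ) ≤ p * M / 2} with hB1
  set B2 : Set (Fin (n + m - 1) → ℝ) := {h | ε * ((n + m - 1 : ℕ) : ℝ) ≤
    ∑ k, max (|h k| - T) 0} with hB2
  have hP1 : (gaussPi (n + m - 1)).real B1 ≤ Real.exp (-(2 * c * n)) := by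
    refine (blocks_prob (n + m - 1) M L (blkG n m hm) (blkG_inj n m hm) (blockS m)
      (blockS_meas m) p hp).trans (Real.exp_le_exp.2 (neg_le_neg ?_))
    calc 2 * c * n ≤ p ^ 2 / (4 * L) * n := by gcongr
      _ = p ^ 2 * (n / (2 * L)) / 2 := by field_simp; norm_num
      _ ≤ _ := by gcongr
  have hd : (n:ℝ) ≤ ((n + m - 1 : ℕ) : ℝ) := by
    have : n ≤ n + m - 1 := by omega
    exact_mod_cast this
  have hd2 : ((n + m - 1 : ℕ) : ℝ) ≤ 2 * n := by
    have : n + m - 1 ≤ 2 * n := by omega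
    exact_mod_cast this
  have hP2 : (gaussPi (n + m - 1)).real B2 ≤ Real.exp (-(2 * c * n)) := by
    refine (hexc (n + m - 1)).trans (Real.exp_le_exp.2 (neg_le_neg ?_))
    gcongr
  have hee : 2 * Real.exp (-(2 * c * n)) ≤ Real.exp (-c * n) := by
    have e1 : Real.exp (-c * n) = Real.exp (-(2 * c * n)) * Real.exp (c * n) := by
      rw [← Real.exp_add]; congr 1; ring
    have e2 : 2 ≤ Real.exp (c * n) := by
      have := Real.add_one_le_exp (c * n); linarith
    rw [e1]
    nlinarith [Real.exp_pos (-(2 * c * n))]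
  set Good : Set (Fin (n + m - 1) → ℝ) := {h | ∀ z : Fin m → ℝ, l2 z = 1 →
              ∀ K : Finset (Fin n), (K.card : ℝ) ≤ p / (64 * L * m * T) * n →
                p / (16 * L) * ((n : ℝ) * Real.sqrt (2 / Real.pi)) ≤
                  ∑ i ∈ Kᶜ, |(toeplitz n m h).mulVec z i| -
                    ∑ i ∈ K, |(toeplitz n m h).mulVec z i|} with hGood
  have hcover : (Set.univ : Set (Fin (n + m - 1) → ℝ)) ⊆ Good ∪ (B1 ∪ B2) := by
    intro h _
    by_contra hcon
    simp only [Set.mem_union, not_or] at hcon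
    obtain ⟨hg, hb1, hb2⟩ := hcon
    apply hg
    intro z hz K hK
    simp only [hB1, hB2, Set.mem_ofPred_eq, not_le] at hb1 hb2
    have t1 := total_lower n m hm h z hz
    have t2 := K_upper n m h z hz T K
    have t3 := Finset.sum_add_sum_compl K (fun i => |(toeplitz n m h).mulVec z i|)
    have t4 : (m:ℝ) * T * K.card ≤ p / (64 * L) * n := by
      calc (m:ℝ) * T * K.card ≤ m * T * (p / (64 * L * m * T) * n) := by gcongr
        _ = _ := by field_simp
    have t5 : (m:ℝ) * ∑ k, max (|h k| - T) 0 ≤ p / (64 * L) * n := by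
      calc (m:ℝ) * ∑ k, max (|h k| - T) 0 ≤ m * (ε * (2 * n)) := by
            gcongr
            exact hb2.le.trans (by gcongr)
        _ = _ := by rw [hε]; field_simp; norm_num
    have t6 : p / (8 * L) * n ≤ p * M / 2 / 2 := by
      calc p / (8 * L) * n = p * (n / (2 * L)) / 2 / 2 := by field_simp; norm_num
        _ ≤ _ := by gcongr
    have t7 : p / (16 * L) * ((n : ℝ) * Real.sqrt (2 / Real.pi)) ≤ p / (16 * L) * n := by
      have : Real.sqrt (2 / Real.pi) ≤ 1 := by
        rw [Real.sqrt_le_one, div_le_one Real.pi_pos]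
        linarith [Real.pi_gt_three]
      gcongr
      exact mul_le_of_le_one_right hn0.le this
    have e1 : p / (8 * L) * n = 2 * (p / (16 * L) * n) := by field_simp; norm_num
    have e2 : p / (16 * L) * n = 4 * (p / (64 * L) * n) := by field_simp; norm_num
    linarith
  have h1 : (1:ℝ) ≤ (gaussPi (n + m - 1)).real Good +
      ((gaussPi (n + m - 1)).real B1 + (gaussPi (n + m - 1)).real B2) := by
    calc (1:ℝ) = (gaussPi (n + m - 1)).real Set.univ := by simp
      _ ≤ (gaussPi (n + m - 1)).real (Good ∪ (B1 ∪ B2)) := measureReal_mono hcover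
      _ ≤ _ := (measureReal_union_le _ _).trans (by
          gcongr; exact measureReal_union_le _ _)
  have h2 : 1 - Real.exp (-c * n) ≤ (gaussPi (n + m - 1)).real Good := by linarith
  exact (ENNReal.ofReal_le_ofReal h2).trans (by rw [ofReal_measureReal])
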